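/- Let N ≥ 2 and 1 < p ≤ N. Suppose u ≥ 0 is classically p-superharmonic on the punctured space {x : x ≠ 0} ⊆ EuclideanSpace ℝ (Fin N). Then the function m(r) = inf { u(x) : r < ‖x‖ < 2r } is nonincreasing on (0,∞): for all r, s with 0 < r ≤ s one has m(s) ≤ m(r). -/

import Mathlib

open MeasureTheory Filter Real Matrix
open scoped RealInnerProductSpace

/-- The vector field `F_p u (x) = ‖∇u(x)‖^(p-2) • ∇u(x)` (real power; equal to `0`
when `∇u(x) = 0`). -/
noncomputable def pFlux (N : ℕ) (p : ℝ) (u : EuclideanSpace ℝ (Fin N) → ℝ)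
    (x : EuclideanSpace ℝ (Fin N)) : EuclideanSpace ℝ (Fin N) :=
  ‖gradient u x‖ ^ (p - 2) • gradient u x

/-- The `p`-Laplacian `Δ_p u (x) = div (F_p u) (x)`. -/
noncomputable def pLaplacian (N : ℕ) (p : ℝ) (u : EuclideanSpace ℝ (Fin N) → ℝ)
    (x : EuclideanSpace ℝ (Fin N)) : ℝ :=
  ∑ i : Fin N, ⟪fderiv ℝ (pFlux N p u) x (EuclideanSpace.basisFun (Fin N) ℝ i),
      EuclideanSpace.basisFun (Fin N) ℝ i⟫

/-- `u` is a classical supersolution of `-Δ_p u ≥ g` on `Ω`. -/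
def IsPSupersolution (N : ℕ) (p : ℝ) (u : EuclideanSpace ℝ (Fin N) → ℝ)
    (g : EuclideanSpace ℝ (Fin N) → ℝ) (Ω : Set (EuclideanSpace ℝ (Fin N))) : Prop :=
  ContDiffOn ℝ 1 u Ω ∧ DifferentiableOn ℝ (pFlux N p u) Ω ∧
    ∀ x ∈ Ω, -pLaplacian N p u x ≥ g x

theorem norm_rpow_eq_sq_rpow_half {F : Type*} [NormedAddCommGroup F] (v : F) (a : ℝ) : ‖v‖ ^ a = (‖v‖ ^ 2) ^ (a / 2) := by
  rw [← Real.rpow_natCast, ← Real.rpow_mul (norm_nonneg v)]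
  congr 1
  push_cast
  ring

section Auxiliary

variable {E : Type*} [NormedAddCommGroup E] [InnerProductSpace ℝ E]

theorem hasFDerivAt_normSq_rpow_smul {V : E → E} {B : E →L[ℝ] E} {x : E}
    (hV : HasFDerivAt V B x) (hx : V x ≠ 0) (α : ℝ) :
    HasFDerivAt (fun y => (‖V y‖ ^ 2) ^ α • V y)
      ((‖V x‖ ^ 2) ^ α • B +
        ((2 * α * (‖V x‖ ^ 2) ^ (α - 1)) • (innerSL ℝ (V x) ∘L B)).smulRight (V x)) x := by
  have hne : ‖V x‖ ^ 2 ≠ 0 := by positivity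
  have h := (hV.norm_sq.rpow_const (p := α) (Or.inl hne)).fun_smul hV
  refine h.congr_fderiv ?_
  ext e
  simp
  ring_nf

/-- The bilinear expression `tr B + (p - 2) ⟪ξ, B ξ⟫ / ‖ξ‖²`, i.e. the normalized trace of `B`
against the coefficient matrix of the `p`-Laplacian at gradient direction `ξ`. -/
noncomputable def normalizedTrace {ι : Type*} [Fintype ι] (b : OrthonormalBasis ι ℝ E) (p : ℝ)
    (ξ : E) (B : E →L[ℝ] E) : ℝ :=
  ∑ i, ⟪B (b i), b i⟫ + (p - 2) * (⟪ξ, B ξ⟫ / ‖ξ‖ ^ 2)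

theorem sum_inner_smul_add_smulRight {ι : Type*} [Fintype ι] (b : OrthonormalBasis ι ℝ E)
    (B : E →L[ℝ] E) (ξ : E) (c d : ℝ) :
    ∑ i, ⟪(c • B + (d • (innerSL ℝ ξ ∘L B)).smulRight ξ) (b i), b i⟫ =
      c * ∑ i, ⟪B (b i), b i⟫ + d * ⟪ξ, B ξ⟫ := by
  have key : ∑ i, ⟪ξ, B (b i)⟫ * ⟪ξ, b i⟫ = ⟪ξ, B ξ⟫ := by
    conv_rhs => rw [← b.sum_repr' ξ]
    rw [map_sum, b.sum_repr' ξ, inner_sum]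
    refine Finset.sum_congr rfl fun i _ => ?_
    rw [map_smul, inner_smul_right, real_inner_comm ξ (b i)]
    ring
  rw [← key, Finset.mul_sum, Finset.mul_sum, ← Finset.sum_add_distrib]
  refine Finset.sum_congr rfl fun i _ => ?_
  simp [inner_add_left, inner_smul_left]
  ring

theorem inner_div_normSq_le_sum_inner {ι : Type*} [Fintype ι] (b : OrthonormalBasis ι ℝ E)
    {B : E →L[ℝ] E} (hB : ∀ e, 0 ≤ ⟪B e, e⟫) {ξ : E} (hξ : ξ ≠ 0) :
    ⟪ξ, B ξ⟫ / ‖ξ‖ ^ 2 ≤ ∑ i, ⟪B (b i), b i⟫ := by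
  classical
  have hfin : FiniteDimensional ℝ E := b.toBasis.finiteDimensional_of_finite
  have hcard : Module.finrank ℝ E = Fintype.card ι := Module.finrank_eq_card_basis b.toBasis
  have hι : Nonempty ι := by
    rw [← Fintype.card_pos_iff, ← hcard]
    exact Module.finrank_pos_iff_exists_ne_zero.2 ⟨ξ, hξ⟩
  obtain ⟨i₀⟩ := hι
  set ν : E := ‖ξ‖⁻¹ • ξ with hν
  have hξn : ‖ξ‖ ≠ 0 := norm_ne_zero_iff.2 hξ
  have hνn : ‖ν‖ = 1 := by rw [hν, norm_smul, norm_inv, norm_norm, inv_mul_cancel₀ hξn]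
  obtain ⟨c, hc⟩ := Orthonormal.exists_orthonormalBasis_extension_of_card_eq (𝕜 := ℝ) hcard
    (v := fun _ : ι => ν) (s := {i₀}) (by
      constructor
      · intro i
        simpa using hνn
      · intro i j hij
        exact absurd (Subsingleton.elim i j) hij)
  have htr : ∑ i, ⟪B (b i), b i⟫ = ∑ i, ⟪B (c i), c i⟫ := by
    have h1 := LinearMap.trace_eq_sum_inner (B : E →ₗ[ℝ] E) b
    have h2 := LinearMap.trace_eq_sum_inner (B : E →ₗ[ℝ] E) c
    simp only [ContinuousLinearMap.coe_coe] at h1 h2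
    simp only [real_inner_comm (b _) _, real_inner_comm (c _) _] at *
    exact h1.symm.trans h2
  have hci : c i₀ = ν := hc i₀ rfl
  have hval : ⟪ξ, B ξ⟫ / ‖ξ‖ ^ 2 = ⟪B (c i₀), c i₀⟫ := by
    rw [hci, hν, map_smul, inner_smul_left, inner_smul_right, real_inner_comm]
    simp
    field_simp
  rw [htr, hval]
  exact Finset.single_le_sum (f := fun i => ⟪B (c i), c i⟫) (fun i _ => hB (c i))
    (Finset.mem_univ i₀)

theorem normalizedTrace_nonneg {ι : Type*} [Fintype ι] (b : OrthonormalBasis ι ℝ E) {p : ℝ}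
    (hp : 1 ≤ p) {B : E →L[ℝ] E} (hB : ∀ e, 0 ≤ ⟪B e, e⟫) {ξ : E} (hξ : ξ ≠ 0) :
    0 ≤ normalizedTrace b p ξ B := by
  have h1 := inner_div_normSq_le_sum_inner b hB hξ
  have h2 : 0 ≤ ⟪ξ, B ξ⟫ / ‖ξ‖ ^ 2 := by
    rw [real_inner_comm]
    exact div_nonneg (hB ξ) (by positivity)
  unfold normalizedTrace
  nlinarith [mul_nonneg (sub_nonneg.2 hp) h2]

theorem normalizedTrace_sub {ι : Type*} [Fintype ι] (b : OrthonormalBasis ι ℝ E) (p : ℝ) (ξ : E)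
    (B C : E →L[ℝ] E) :
    normalizedTrace b p ξ (B - C) = normalizedTrace b p ξ B - normalizedTrace b p ξ C := by
  simp only [normalizedTrace, _root_.sub_apply, inner_sub_left, inner_sub_right,
    Finset.sum_sub_distrib]
  ring

theorem normalizedTrace_smul {ι : Type*} [Fintype ι] (b : OrthonormalBasis ι ℝ E) (p : ℝ) {c : ℝ}
    (hc : c ≠ 0) (ξ : E) (B : E →L[ℝ] E) :
    normalizedTrace b p (c • ξ) B = normalizedTrace b p ξ B := by
  simp only [normalizedTrace, map_smul, inner_smul_left, inner_smul_right, norm_smul, mul_pow]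
  congr 2
  simp only [Real.norm_eq_abs, sq_abs, conj_trivial]
  rw [← mul_assoc, ← sq, mul_div_mul_left _ _ (pow_ne_zero 2 hc)]

/-- Second-order necessary condition at a local minimum, assuming only that the gradient is
differentiable at the point. -/
theorem IsLocalMin.inner_fderiv_gradient_nonneg [CompleteSpace E] {w : E → ℝ} {W : E → E}
    {B : E →L[ℝ] E} {x : E} (hmin : IsLocalMin w x)
    (hw : ∀ᶠ y in nhds x, HasGradientAt w (W y) y) (hW : HasFDerivAt W B x) (e : E) :
    0 ≤ ⟪B e, e⟫ := by
  have hline : ∀ t : ℝ, HasDerivAt (fun t : ℝ => x + t • e) e t := fun t => by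
    simpa using ((hasDerivAt_id t).smul_const e).const_add x
  have hcont : Tendsto (fun t : ℝ => x + t • e) (nhds 0) (nhds x) := by
    simpa using (hline 0).continuousAt.tendsto
  have hd : ∀ᶠ t : ℝ in nhds 0, HasDerivAt (fun t : ℝ => w (x + t • e)) ⟪W (x + t • e), e⟫ t := by
    filter_upwards [hcont.eventually hw] with t ht
    simpa [Function.comp_def] using ht.hasFDerivAt.comp_hasDerivAt t (hline t)
  have hmin' : IsLocalMin (fun t : ℝ => w (x + t • e)) 0 := by
    simpa [IsLocalMin, IsMinFilter] using hcont.eventually hmin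
  have hdd : HasDerivAt (fun t : ℝ => ⟪W (x + t • e), e⟫) ⟪B e, e⟫ 0 := by
    have h0 : HasFDerivAt W B (x + (0 : ℝ) • e) := by simpa using hW
    simpa using (h0.comp_hasDerivAt (0 : ℝ) (hline 0)).inner ℝ (hasDerivAt_const (0 : ℝ) e)
  have hderiv : deriv (fun t : ℝ => w (x + t • e)) =ᶠ[nhds 0] fun t => ⟪W (x + t • e), e⟫ :=
    hd.mono fun t ht => ht.deriv
  have hval : deriv (deriv fun t : ℝ => w (x + t • e)) 0 = ⟪B e, e⟫ := by
    rw [hderiv.deriv_eq, hdd.deriv]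
  by_contra! hneg
  have hmax : IsLocalMax (fun t : ℝ => w (x + t • e)) 0 :=
    isLocalMax_of_deriv_deriv_neg (hval ▸ hneg) hmin'.deriv_eq_zero
      hd.self_of_nhds.continuousAt
  have hconst : (fun t : ℝ => w (x + t • e)) =ᶠ[nhds 0] fun _ => w (x + (0 : ℝ) • e) := by
    filter_upwards [hmin', hmax] with t h1 h2 using le_antisymm h2 h1
  have hz : deriv (deriv fun t : ℝ => w (x + t • e)) 0 = 0 := by
    rw [hconst.deriv.deriv_eq]
    simp
  linarith

theorem hasGradientAt_normSq_rpow [CompleteSpace E] {x : E} (hx : x ≠ 0) (k γ : ℝ) :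
    HasGradientAt (fun y : E => k * (‖y‖ ^ 2) ^ γ)
      ((2 * k * γ) • ((‖x‖ ^ 2) ^ (γ - 1) • x)) x := by
  have hne : ‖x‖ ^ 2 ≠ 0 := by positivity
  rw [hasGradientAt_iff_hasFDerivAt]
  have h := ((hasFDerivAt_id (𝕜 := ℝ) x).norm_sq.rpow_const (p := γ) (Or.inl hne)).const_mul k
  refine HasFDerivAt.congr_fderiv (f := fun y : E => k * (‖y‖ ^ 2) ^ γ) h ?_
  ext e
  simp
  ring

/-- Comparison at a touching point: if `u` has gradient `U` which is differentiable at `x`, and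
`u - k (‖·‖²)^γ` has a local minimum at `x ≠ 0`, then the normalized `p`-trace of the Hessian of
`u` is positive. -/
theorem normalizedTrace_pos_of_isLocalMin [CompleteSpace E] {ι : Type*} [Fintype ι]
    (b : OrthonormalBasis ι ℝ E) {p k γ : ℝ} (hp : 1 < p) (hpN : p ≤ Fintype.card ι)
    (hk : 0 < k) (hγ : 0 < γ) {u : E → ℝ} {U : E → E} {B : E →L[ℝ] E} {x : E} (hx : x ≠ 0)
    (hu : ∀ᶠ y in nhds x, HasGradientAt u (U y) y) (hU : HasFDerivAt U B x)
    (hmin : IsLocalMin (fun y => u y - k * (‖y‖ ^ 2) ^ γ) x) :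
    0 < normalizedTrace b p x B := by
  have hpos : 0 < ‖x‖ ^ 2 := by positivity
  have hv : ∀ᶠ y in nhds x, HasGradientAt (fun y : E => k * (‖y‖ ^ 2) ^ γ)
      ((2 * k * γ) • ((‖y‖ ^ 2) ^ (γ - 1) • y)) y :=
    (eventually_ne_nhds hx).mono fun y hy => hasGradientAt_normSq_rpow hy k γ
  have hV := (hasFDerivAt_normSq_rpow_smul (hasFDerivAt_id (𝕜 := ℝ) x) hx (γ - 1)).const_smul
    (2 * k * γ)
  simp only [id] at hV
  set C := (2 * k * γ) • ((‖x‖ ^ 2) ^ (γ - 1) • ContinuousLinearMap.id ℝ E +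
    ((2 * (γ - 1) * (‖x‖ ^ 2) ^ (γ - 1 - 1)) •
      (innerSL ℝ x ∘L ContinuousLinearMap.id ℝ E)).smulRight x) with hC
  have hform := hmin.inner_fderiv_gradient_nonneg (hu.and hv |>.mono fun y hy => by
    have := hy.1.hasFDerivAt.sub hy.2.hasFDerivAt
    rw [hasGradientAt_iff_hasFDerivAt, Pi.sub_apply, Pi.smul_apply, map_sub]
    exact this) (hU.sub hV)
  have h := normalizedTrace_nonneg b hp.le hform hx
  rw [normalizedTrace_sub] at h
  have hCpos : 0 < normalizedTrace b p x C := by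
    have hpow : (‖x‖ ^ 2) ^ (γ - 1) = (‖x‖ ^ 2) ^ (γ - 1 - 1) * ‖x‖ ^ 2 := by
      rw [← Real.rpow_add_one hpos.ne']
      congr 1
      ring
    have htr : ∑ i, ⟪C (b i), b i⟫ = (2 * k * γ) * ((‖x‖ ^ 2) ^ (γ - 1) * Fintype.card ι +
        (2 * (γ - 1) * (‖x‖ ^ 2) ^ (γ - 1 - 1)) * ‖x‖ ^ 2) := by
      have := sum_inner_smul_add_smulRight b (ContinuousLinearMap.id ℝ E) x
        ((‖x‖ ^ 2) ^ (γ - 1)) (2 * (γ - 1) * (‖x‖ ^ 2) ^ (γ - 1 - 1))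
      simp only [ContinuousLinearMap.id_apply, real_inner_self_eq_norm_sq, b.norm_eq_one,
        one_pow, Finset.sum_const, Finset.card_univ, nsmul_eq_mul, mul_one] at this
      rw [← this, Finset.mul_sum]
      simp only [hC, _root_.smul_apply, real_inner_smul_left]
    have hin : ⟪x, C x⟫ / ‖x‖ ^ 2 = (2 * k * γ) * ((‖x‖ ^ 2) ^ (γ - 1) +
        (2 * (γ - 1) * (‖x‖ ^ 2) ^ (γ - 1 - 1)) * ‖x‖ ^ 2) := by
      rw [div_eq_iff hpos.ne', hC]
      simp only [_root_.smul_apply, _root_.add_apply,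
        ContinuousLinearMap.smulRight_apply, ContinuousLinearMap.comp_apply,
        ContinuousLinearMap.id_apply, innerSL_apply_apply, inner_smul_right, inner_add_right,
        real_inner_self_eq_norm_sq, smul_eq_mul]
      ring
    have heq : normalizedTrace b p x C = (2 * k * γ) * (‖x‖ ^ 2) ^ (γ - 1) *
        ((Fintype.card ι - p) + 2 * γ * (p - 1)) := by
      rw [normalizedTrace, htr, hin, hpow]
      ring
    rw [heq]
    have : 0 < p - 1 := sub_pos.2 hp
    have : 0 ≤ (Fintype.card ι : ℝ) - p := sub_nonneg.2 hpN
    positivity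
  linarith

end Auxiliary

section Euclidean

variable {N : ℕ} {p : ℝ} {u : EuclideanSpace ℝ (Fin N) → ℝ} {x : EuclideanSpace ℝ (Fin N)}

theorem gradient_eq_rpow_smul_pFlux (hp : 1 < p) (u : EuclideanSpace ℝ (Fin N) → ℝ)
    (x : EuclideanSpace ℝ (Fin N)) :
    gradient u x = (‖pFlux N p u x‖ ^ 2) ^ ((2 - p) / (p - 1) / 2) • pFlux N p u x := by
  rw [← norm_rpow_eq_sq_rpow_half]
  by_cases h : gradient u x = 0
  · simp [pFlux, h]
  have hn : 0 < ‖gradient u x‖ := norm_pos_iff.2 h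
  have hp' : p - 1 ≠ 0 := (sub_pos.2 hp).ne'
  have hnorm : ‖pFlux N p u x‖ = ‖gradient u x‖ ^ (p - 1) := by
    rw [pFlux, norm_smul, Real.norm_of_nonneg (by positivity), ← Real.rpow_add_one hn.ne']
    congr 1
    ring
  rw [hnorm, ← Real.rpow_mul hn.le, mul_div_cancel₀ _ hp', pFlux, smul_smul,
    ← Real.rpow_add hn]
  simp

theorem differentiableAt_gradient_of_pFlux (hp : 1 < p)
    (hF : DifferentiableAt ℝ (pFlux N p u) x) (hx : gradient u x ≠ 0) :
    DifferentiableAt ℝ (gradient u) x := by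
  have hne : pFlux N p u x ≠ 0 :=
    smul_ne_zero (Real.rpow_pos_of_pos (norm_pos_iff.2 hx) _).ne' hx
  rw [show gradient u = _ from funext (gradient_eq_rpow_smul_pFlux hp u)]
  exact (hasFDerivAt_normSq_rpow_smul hF.hasFDerivAt hne _).differentiableAt

theorem pLaplacian_eq_normalizedTrace {B : EuclideanSpace ℝ (Fin N) →L[ℝ] EuclideanSpace ℝ (Fin N)}
    (hB : HasFDerivAt (gradient u) B x) (hx : gradient u x ≠ 0) :
    pLaplacian N p u x = ‖gradient u x‖ ^ (p - 2) *
      normalizedTrace (EuclideanSpace.basisFun (Fin N) ℝ) p (gradient u x) B := by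
  have hpos : 0 < ‖gradient u x‖ ^ 2 := by positivity
  have hflux : pFlux N p u =
      fun y => (‖gradient u y‖ ^ 2) ^ ((p - 2) / 2) • gradient u y := by
    ext1 y
    rw [pFlux, norm_rpow_eq_sq_rpow_half]
  rw [pLaplacian, hflux, (hasFDerivAt_normSq_rpow_smul hB hx _).fderiv,
    sum_inner_smul_add_smulRight, norm_rpow_eq_sq_rpow_half, normalizedTrace,
    Real.rpow_sub_one hpos.ne']
  ring

theorem not_isLocalMin_sub_normSq_rpow (hp : 1 < p) (hpN : p ≤ N) {k γ : ℝ} (hk : 0 < k)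
    (hγ : 0 < γ) (hu : IsPSupersolution N p u (fun _ => 0) {x | x ≠ 0}) (hx : x ≠ 0) :
    ¬ IsLocalMin (fun y => u y - k * (‖y‖ ^ 2) ^ γ) x := by
  intro hmin
  obtain ⟨hC, hF, hL⟩ := hu
  have hgrad : ∀ y : EuclideanSpace ℝ (Fin N), y ≠ 0 → HasGradientAt u (gradient u y) y :=
    fun y hy => ((hC.differentiableOn one_ne_zero).differentiableAt
      (isOpen_ne.mem_nhds hy)).hasGradientAt
  have hc : 2 * k * γ * (‖x‖ ^ 2) ^ (γ - 1) ≠ 0 := by positivity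
  have hξ : gradient u x = (2 * k * γ * (‖x‖ ^ 2) ^ (γ - 1)) • x := by
    have h := hmin.hasFDerivAt_eq_zero
      ((hgrad x hx).hasFDerivAt.sub (hasGradientAt_normSq_rpow hx k γ).hasFDerivAt)
    rw [← map_sub, map_eq_zero_iff _ (LinearIsometryEquiv.injective _), sub_eq_zero] at h
    rw [h, smul_smul]
  have hne : gradient u x ≠ 0 := hξ ▸ smul_ne_zero hc hx
  have hB := (differentiableAt_gradient_of_pFlux hp
    (hF.differentiableAt (isOpen_ne.mem_nhds hx)) hne).hasFDerivAt
  have hpos := normalizedTrace_pos_of_isLocalMin (EuclideanSpace.basisFun (Fin N) ℝ) hp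
    (by simpa using hpN) hk hγ hx ((eventually_ne_nhds hx).mono hgrad) hB hmin
  have hlap := pLaplacian_eq_normalizedTrace (p := p) hB hne
  have hnn : 0 < ‖gradient u x‖ ^ (p - 2) := Real.rpow_pos_of_pos (norm_pos_iff.2 hne) _
  have := hL x hx
  rw [hξ, normalizedTrace_smul _ _ hc, ← hξ] at hlap
  nlinarith [mul_pos hnn hpos]

theorem rpow_mul_le_of_le_on_sphere (hp : 1 < p) (hpN : p ≤ N)
    (hu_nonneg : ∀ y : EuclideanSpace ℝ (Fin N), y ≠ 0 → 0 ≤ u y)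
    (hu : IsPSupersolution N p u (fun _ => 0) {x | x ≠ 0}) {t M γ : ℝ} (ht : 0 < t)
    (hM : 0 < M) (hγ : 0 < γ) (hsph : ∀ y : EuclideanSpace ℝ (Fin N), ‖y‖ = t → M ≤ u y)
    (hx : x ≠ 0) (hxt : ‖x‖ ≤ t) :
    M / (t ^ 2) ^ γ * (‖x‖ ^ 2) ^ γ ≤ u x := by
  by_contra! hlt
  have hk : 0 < M / (t ^ 2) ^ γ := by positivity
  set k := M / (t ^ 2) ^ γ with hkdef
  have hvcont : Continuous fun y : EuclideanSpace ℝ (Fin N) => k * (‖y‖ ^ 2) ^ γ :=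
    continuous_const.mul ((continuous_norm.pow 2).rpow_const fun _ => Or.inr hγ.le)
  have hsmall : ∀ᶠ y : EuclideanSpace ℝ (Fin N) in nhds 0,
      k * (‖y‖ ^ 2) ^ γ < k * (‖x‖ ^ 2) ^ γ - u x := by
    have h0 := hvcont.tendsto 0
    refine h0.eventually_lt_const ?_
    simpa [Real.zero_rpow hγ.ne'] using hlt
  obtain ⟨ε, hε, hball⟩ := Metric.eventually_nhds_iff.1 hsmall
  set K : Set (EuclideanSpace ℝ (Fin N)) := Metric.closedBall 0 t \ Metric.ball 0 (ε / 2) with hK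
  have hKc : IsCompact K := (isCompact_closedBall 0 t).diff Metric.isOpen_ball
  have hK0 : ∀ y ∈ K, y ≠ 0 := by
    rintro y hy rfl
    exact hy.2 (Metric.mem_ball_self (by positivity))
  have hxε : ε ≤ ‖x‖ := by
    by_contra! h
    have := hball (y := x) (by simpa using h)
    linarith [hu_nonneg x hx]
  have hxK : x ∈ K := ⟨by simpa using hxt, by simp; linarith⟩
  obtain ⟨z, hzK, hz⟩ := hKc.exists_isMinOn ⟨x, hxK⟩
    (f := fun y => u y - k * (‖y‖ ^ 2) ^ γ)
    ((hu.1.continuousOn.mono hK0).sub hvcont.continuousOn)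
  have hzx : u z - k * (‖z‖ ^ 2) ^ γ ≤ u x - k * (‖x‖ ^ 2) ^ γ := hz hxK
  have hz0 := hK0 z hzK
  have hzε : ε ≤ ‖z‖ := by
    by_contra! h
    have := hball (y := z) (by simpa using h)
    linarith [hu_nonneg z hz0]
  have hzt : ‖z‖ < t := by
    refine lt_of_le_of_ne (by simpa using hzK.1) fun h => ?_
    have h1 : k * (‖z‖ ^ 2) ^ γ = M := by
      rw [h, hkdef, div_mul_cancel₀ _ (by positivity)]
    linarith [hsph z h]
  refine not_isLocalMin_sub_normSq_rpow hp hpN hk hγ hu hz0 (hz.isLocalMin ?_)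
  have h1 : ∀ᶠ y in nhds z, ‖y‖ < t := continuous_norm.continuousAt.eventually_lt_const hzt
  have h2 : ∀ᶠ y in nhds z, ε / 2 < ‖y‖ :=
    continuous_norm.continuousAt.eventually_const_lt (by linarith)
  filter_upwards [h1, h2] with y hy1 hy2
  exact ⟨by simpa using hy1.le, by simpa using hy2.le⟩

/-- Minimum principle on the punctured ball: the origin is removable since `p ≤ N`. -/
theorem le_of_le_on_sphere (hp : 1 < p) (hpN : p ≤ N)
    (hu_nonneg : ∀ y : EuclideanSpace ℝ (Fin N), y ≠ 0 → 0 ≤ u y)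
    (hu : IsPSupersolution N p u (fun _ => 0) {x | x ≠ 0}) {t M : ℝ} (ht : 0 < t)
    (hsph : ∀ y : EuclideanSpace ℝ (Fin N), ‖y‖ = t → M ≤ u y)
    (hx : x ≠ 0) (hxt : ‖x‖ ≤ t) : M ≤ u x := by
  rcases le_or_gt M 0 with hM | hM
  · exact hM.trans (hu_nonneg x hx)
  have hx2 : ‖x‖ ^ 2 ≠ 0 := by positivity
  have hcont : Continuous fun γ : ℝ => M / (t ^ 2) ^ γ * (‖x‖ ^ 2) ^ γ :=
    (continuous_const.div (Real.continuous_const_rpow (by positivity))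
      fun γ => by positivity).mul (Real.continuous_const_rpow hx2)
  have hlim : Tendsto (fun γ : ℝ => M / (t ^ 2) ^ γ * (‖x‖ ^ 2) ^ γ)
      (nhdsWithin 0 (Set.Ioi 0)) (nhds M) := by
    simpa using (hcont.tendsto 0).mono_left nhdsWithin_le_nhds
  refine le_of_tendsto hlim ?_
  filter_upwards [self_mem_nhdsWithin] with γ hγ
  exact rpow_mul_le_of_le_on_sphere hp hpN hu_nonneg hu ht hM hγ hsph hx hxt

end Euclidean

/-- If `N ≥ 2`, `1 < p ≤ N`, and `u ≥ 0` is classically `p`-superharmonic on the punctured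
space `{x ≠ 0}`, then `m(r) = inf_{r < ‖x‖ < 2r} u(x)` is nonincreasing on `(0,∞)`. -/
theorem m_antitone_punctured (N : ℕ) (hN : 2 ≤ N) (p : ℝ) (hp : 1 < p) (hpN : p ≤ (N : ℝ))
    (u : EuclideanSpace ℝ (Fin N) → ℝ)
    (hu_nonneg : ∀ x : EuclideanSpace ℝ (Fin N), x ≠ 0 → 0 ≤ u x)
    (hu_super : IsPSupersolution N p u (fun _ => 0)
      {x : EuclideanSpace ℝ (Fin N) | x ≠ 0}) :
    ∀ r s : ℝ, 0 < r → r ≤ s →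
      sInf (u '' {x : EuclideanSpace ℝ (Fin N) | s < ‖x‖ ∧ ‖x‖ < 2 * s}) ≤
      sInf (u '' {x : EuclideanSpace ℝ (Fin N) | r < ‖x‖ ∧ ‖x‖ < 2 * r}) := by
  intro r s hr hrs
  have hs : 0 < s := hr.trans_le hrs
  have : Nonempty (Fin N) := ⟨⟨0, by omega⟩⟩
  have hne : (u '' {x : EuclideanSpace ℝ (Fin N) | r < ‖x‖ ∧ ‖x‖ < 2 * r}).Nonempty := by
    obtain ⟨y, hy⟩ := exists_norm_eq (EuclideanSpace ℝ (Fin N)) (c := 3 / 2 * r) (by positivity)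
    exact ⟨u y, y, ⟨by linarith, by linarith⟩, rfl⟩
  have hle : ∀ y : EuclideanSpace ℝ (Fin N), s < ‖y‖ → ‖y‖ < 2 * s →
      sInf (u '' {x : EuclideanSpace ℝ (Fin N) | s < ‖x‖ ∧ ‖x‖ < 2 * s}) ≤ u y := by
    refine fun y hy1 hy2 => csInf_le ⟨0, ?_⟩ ⟨y, ⟨hy1, hy2⟩, rfl⟩
    rintro _ ⟨z, ⟨hz, -⟩, rfl⟩
    exact hu_nonneg z (norm_pos_iff.1 (hs.trans hz))
  refine le_csInf hne ?_
  rintro _ ⟨x, ⟨hx1, hx2⟩, rfl⟩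
  rcases lt_or_ge s ‖x‖ with h | h
  · exact hle x h (by linarith)
  · refine le_of_le_on_sphere (t := 3 / 2 * s) hp hpN hu_nonneg hu_super (by positivity)
      (fun y hy => hle y (by linarith) (by linarith)) (norm_pos_iff.1 (hr.trans hx1))
      (by linarith)
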